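/- If two call sequences σ and τ have equal epistemic pair-views, Ṽ(σ) = Ṽ(τ), then for every formula φ of L_wn (no nested common knowledge operators): (M, σ) ⊨ φ if and only if (M, τ) ⊨ φ. -/

import Mathlib

namespace Gossip

/-- A call between two distinct agents. -/
structure Call (A : Type) where
  x : A
  y : A
  ne : x ≠ y

variable {A : Type} [DecidableEq A]

/-- Agent `a` is involved in the call `c`. -/
def Call.involves (c : Call A) (a : A) : Prop := a = c.x ∨ a = c.y

instance (c : Call A) (a : A) : Decidable (c.involves a) := by
  unfold Call.involves; infer_instance

/-- `c` is the call between agents `a` and `b`. -/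
def Call.isBetween (c : Call A) (a b : A) : Prop :=
  (c.x = a ∧ c.y = b) ∨ (c.x = b ∧ c.y = a)

instance (c : Call A) (a b : A) : Decidable (c.isBetween a b) := by
  unfold Call.isBetween; infer_instance

/-- The effect of a call on a gossip situation: the two agents involved
pool their secrets. -/
def Call.apply (c : Call A) (s : A → Finset A) : A → Finset A :=
  fun d => if d = c.x ∨ d = c.y then s c.x ∪ s c.y else s d

/-- The initial gossip situation: each agent is familiar only with their
own secret (secrets are identified with agents via the fixed bijection). -/
def root : A → Finset A := fun a => {a}

/-- The result of applying a call sequence to a gossip situation. -/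
def applySeq (σ : List (Call A)) (s : A → Finset A) : A → Finset A :=
  σ.foldl (fun t c => c.apply t) s

/-- `∼_a` : the smallest relation with `ε ∼_a ε`, closed under appending
calls not involving `a` on either side, and under appending a call
involving `a` on both sides when it yields the same set of secrets for `a`. -/
inductive AgEquiv (a : A) : List (Call A) → List (Call A) → Prop
  | nil : AgEquiv a [] []
  | extLeft {σ τ : List (Call A)} (c : Call A) :
      ¬ c.involves a → AgEquiv a σ τ → AgEquiv a (σ ++ [c]) τ
  | extRight {σ τ : List (Call A)} (c : Call A) :
      ¬ c.involves a → AgEquiv a σ τ → AgEquiv a σ (τ ++ [c])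
  | call {σ τ : List (Call A)} (c : Call A) :
      c.involves a →
      applySeq (σ ++ [c]) root a = applySeq (τ ++ [c]) root a →
      AgEquiv a σ τ → AgEquiv a (σ ++ [c]) (τ ++ [c])

/-- `∼_G` : reflexive-transitive closure of the union of the `∼_a`, `a ∈ G`. -/
def GEquiv (G : Finset A) : List (Call A) → List (Call A) → Prop :=
  Relation.ReflTransGen (fun σ τ => ∃ a ∈ G, AgEquiv a σ τ)

/-- Formulas of the language `L^ck`. `fam a p` is `F_a p`,
`ck G φ` is `C_G φ`; `K_a φ` is `ck {a} φ`. -/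
inductive Formula (A : Type) where
  | fam : A → A → Formula A
  | neg : Formula A → Formula A
  | conj : Formula A → Formula A → Formula A
  | ck : Finset A → Formula A → Formula A

/-- Truth of a formula at a call sequence (in the gossip model). -/
def Sat : Formula A → List (Call A) → Prop
  | .fam a p, σ => p ∈ applySeq σ root a
  | .neg φ, σ => ¬ Sat φ σ
  | .conj φ ψ, σ => Sat φ σ ∧ Sat ψ σ
  | .ck G φ, σ => ∀ τ, GEquiv G σ τ → Sat φ τ

/-- `M ⊨ φ` : truth at every call sequence. -/
def Truth (φ : Formula A) : Prop := ∀ σ : List (Call A), Sat φ σ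

/-- Formulas with no occurrence of the negation symbol. -/
def NegFree : Formula A → Prop
  | .fam _ _ => True
  | .neg _ => False
  | .conj φ ψ => NegFree φ ∧ NegFree ψ
  | .ck _ φ => NegFree φ

/-- Formulas with no occurrence of the `C_G` modalities (propositional part). -/
def CkFree : Formula A → Prop
  | .fam _ _ => True
  | .neg φ => CkFree φ
  | .conj φ ψ => CkFree φ ∧ CkFree ψ
  | .ck _ _ => False

/-- Formulas of `L_wn`: no nested occurrence of the `C_G` modalities. -/
def NoNested : Formula A → Prop
  | .fam _ _ => True
  | .neg φ => NoNested φ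
  | .conj φ ψ => NoNested φ ∧ NoNested ψ
  | .ck _ φ => CkFree φ

/-- The call `ab` occurs in `σ`. -/
def occursBetween (a b : A) (σ : List (Call A)) : Prop :=
  ∃ c ∈ σ, c.isBetween a b

/-- Epistemic pair-view component `Ṽ(σ)(a,b)`. -/
def pairView (σ : List (Call A)) (a b : A) : Set (A → Finset A) :=
  {s | ∃ τ, GEquiv {a, b} σ τ ∧ s = applySeq τ root}

/-- The full epistemic pair-view `Ṽ(σ)` : all components `Ṽ(σ)(a,b)`
together with the designated situation `Ṽ(σ)(*) = σ(root)`. -/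
def fullView (σ : List (Call A)) : (A → A → Set (A → Finset A)) × (A → Finset A) :=
  (pairView σ, applySeq σ root)

/-- A call sequence is pair-epistemically non-redundant if no nonempty
subsequence `σ₂` of a prefix `σ₁.σ₂` is pair-epistemically redundant. -/
def PairNonRedundant (σ : List (Call A)) : Prop :=
  ∀ σ₁ σ₂ : List (Call A), (σ₁ ++ σ₂) <+: σ → σ₂ ≠ [] →
    fullView σ₁ ≠ fullView (σ₁ ++ σ₂)

/-- Order on gossip situations: componentwise inclusion. -/
def gsLE (s t : A → Finset A) : Prop := ∀ a, s a ⊆ t a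

/-- The order `≤_EPV` on (the pair components of) epistemic pair-views. -/
def epvLE (V W : A → A → Set (A → Finset A)) : Prop :=
  ∀ a b : A, ∃ X : Set (A → Finset A), X ⊆ V a b ∧
    ∃ g : X → W a b, Function.Surjective g ∧ ∀ s : X, gsLE s.1 (g s).1

/-- `σ` is ab-redundant free: no call of `σ` different from the call `ab`
is redundant (leaves the current gossip situation unchanged). -/
def abRedundantFree (a b : A) (σ : List (Call A)) : Prop :=
  ∀ (i : ℕ) (h : i < σ.length), ¬ (σ.get ⟨i, h⟩).isBetween a b →
    (σ.get ⟨i, h⟩).apply (applySeq (σ.take i) root) ≠ applySeq (σ.take i) root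

theorem AgEquiv.refl {A : Type} [DecidableEq A] (a : A) (σ : List (Call A)) :
    AgEquiv a σ σ := by
  induction σ using List.reverseRecOn with
  | nil => exact .nil
  | append_singleton σ c ih =>
    by_cases hc : c.involves a
    · exact .call c hc rfl ih
    · exact .extLeft c hc (.extRight c hc ih)

theorem AgEquiv.symm {A : Type} [DecidableEq A] {a : A} {σ τ : List (Call A)}
    (h : AgEquiv a σ τ) : AgEquiv a τ σ := by
  induction h with
  | nil => exact .nil
  | extLeft c hc _ ih => exact .extRight c hc ih
  | extRight c hc _ ih => exact .extLeft c hc ih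
  | call c hc he _ ih => exact .call c hc he.symm ih

theorem GEquiv.symm {A : Type} [DecidableEq A] {G : Finset A} {σ τ : List (Call A)}
    (h : GEquiv G σ τ) : GEquiv G τ σ :=
  have : Std.Symm fun σ τ : List (Call A) => ∃ a ∈ G, AgEquiv a σ τ :=
    ⟨fun _ _ ⟨a, ha, hστ⟩ => ⟨a, ha, hστ.symm⟩⟩
  Relation.ReflTransGen.stdSymm.symm _ _ h

/-- Every call leaves out some member of a group of at least three agents. -/
theorem Call.exists_not_involves {A : Type} [DecidableEq A] (c : Call A) {G : Finset A}
    (hG : 2 < G.card) : ∃ a ∈ G, ¬ c.involves a := by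
  obtain ⟨a, ha, hc⟩ := Finset.exists_mem_notMem_of_card_lt_card
    (Finset.card_le_two.trans_lt hG : ({c.x, c.y} : Finset A).card < G.card)
  exact ⟨a, ha, by simpa [Call.involves] using hc⟩

theorem gEquiv_nil_of_two_lt_card {A : Type} [DecidableEq A] {G : Finset A}
    (hG : 2 < G.card) (σ : List (Call A)) : GEquiv G σ [] := by
  induction σ using List.reverseRecOn with
  | nil => exact .refl
  | append_singleton σ c ih =>
    obtain ⟨a, ha, hc⟩ := c.exists_not_involves hG
    exact .head ⟨a, ha, .extLeft c hc (.refl a σ)⟩ ih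

theorem gEquiv_of_two_lt_card {A : Type} [DecidableEq A] {G : Finset A}
    (hG : 2 < G.card) (σ τ : List (Call A)) : GEquiv G σ τ :=
  (gEquiv_nil_of_two_lt_card hG σ).trans (gEquiv_nil_of_two_lt_card hG τ).symm

theorem eq_of_gEquiv_empty {A : Type} [DecidableEq A] {σ τ : List (Call A)}
    (h : GEquiv ∅ σ τ) : σ = τ := by
  induction h with
  | refl => rfl
  | tail _ hab _ => simp at hab

theorem sat_iff_of_ckFree {A : Type} [DecidableEq A] {σ τ : List (Call A)}
    (h : applySeq σ root = applySeq τ root) {φ : Formula A} (hφ : CkFree φ) :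
    Sat φ σ ↔ Sat φ τ := by
  induction φ with
  | fam a p => simp only [Sat, h]
  | neg φ ih => exact not_congr (ih hφ)
  | conj φ ψ ihφ ihψ => exact and_congr (ihφ hφ.1) (ihψ hφ.2)
  | ck G φ _ => exact hφ.elim

theorem exists_gEquiv_of_pairView_eq {A : Type} [DecidableEq A] {σ τ ρ : List (Call A)}
    {a b : A} (h : pairView σ a b = pairView τ a b) (hρ : GEquiv {a, b} σ ρ) :
    ∃ ρ', GEquiv {a, b} τ ρ' ∧ applySeq ρ root = applySeq ρ' root :=
  h.subset ⟨ρ, hρ, rfl⟩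

theorem exists_gEquiv_of_fullView_eq {A : Type} [DecidableEq A] {σ τ ρ : List (Call A)}
    (h : fullView σ = fullView τ) {G : Finset A} (hρ : GEquiv G σ ρ) :
    ∃ ρ', GEquiv G τ ρ' ∧ applySeq ρ root = applySeq ρ' root := by
  obtain ⟨hpair, hroot⟩ := Prod.mk.inj h
  rcases lt_or_ge 2 G.card with hG | hG
  · exact ⟨ρ, gEquiv_of_two_lt_card hG τ ρ, rfl⟩
  interval_cases hcard : G.card
  · obtain rfl := Finset.card_eq_zero.mp hcard
    exact ⟨τ, .refl, eq_of_gEquiv_empty hρ ▸ hroot⟩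
  · obtain ⟨a, rfl⟩ := Finset.card_eq_one.mp hcard
    rw [← Finset.pair_eq_singleton] at hρ ⊢
    exact exists_gEquiv_of_pairView_eq (congrFun₂ hpair a a) hρ
  · obtain ⟨a, b, -, rfl⟩ := Finset.card_eq_two.mp hcard
    exact exists_gEquiv_of_pairView_eq (congrFun₂ hpair a b) hρ

theorem sat_ck_of_fullView_eq {A : Type} [DecidableEq A] {σ τ : List (Call A)}
    (h : fullView σ = fullView τ) {G : Finset A} {φ : Formula A} (hφ : CkFree φ)
    (hσ : Sat (.ck G φ) σ) : Sat (.ck G φ) τ := by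
  intro ρ hρ
  obtain ⟨ρ', hρ', heq⟩ := exists_gEquiv_of_fullView_eq h.symm hρ
  exact (sat_iff_of_ckFree heq hφ).mpr (hσ ρ' hρ')

theorem stmt12 {A : Type} [DecidableEq A] [Fintype A] (hA : 3 ≤ Fintype.card A)
    (σ τ : List (Call A)) (h : fullView σ = fullView τ)
    (φ : Formula A) (hφ : NoNested φ) : Sat φ σ ↔ Sat φ τ := by
  induction φ with
  | fam a p => simp only [Sat, (Prod.mk.inj h).2]
  | neg φ ih => exact not_congr (ih hφ)
  | conj φ ψ ihφ ihψ => exact and_congr (ihφ hφ.1) (ihψ hφ.2)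
  | ck G φ _ => exact ⟨sat_ck_of_fullView_eq h hφ, sat_ck_of_fullView_eq h.symm hφ⟩

end Gossip
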